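/- Let (Ge, Go) be a signed graph on a finite vertex type V and let v ∈ V be a vertex whose neighbor set in the union graph Ge ⊔ Go is exactly {u, w} with u ≠ w, such that v is adjacent to u in exactly one of Ge, Go and adjacent to w in exactly one of Ge, Go. Let (Ge₁, Go₁) be the signed graph on V \ {v} (the series reduction at v) defined by: Ge₁.Adj x y iff Ge.Adj x y, or {x, y} = {u, w} and the edges vu, vw have the same parity; Go₁.Adj x y iff Go.Adj x y, or {x, y} = {u, w} and exactly one of vu, vw is odd. Then ν(Ge₁, Go₁) = ν(Ge, Go). -/

import Mathlib

open Matrix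

/-- The set `S(Ge, Go)` of real symmetric matrices compatible with the signed graph
encoded by the pair of simple graphs `(Ge, Go)` (even graph / odd graph). -/
def SignedSet {V : Type*} (Ge Go : SimpleGraph V) : Set (Matrix V V ℝ) :=
  {A | A.IsSymm ∧ ∀ i j,
    ((Ge.Adj i j ∧ ¬ Go.Adj i j) → A i j < 0) ∧
    ((Go.Adj i j ∧ ¬ Ge.Adj i j) → 0 < A i j) ∧
    ((i ≠ j ∧ ¬ Ge.Adj i j ∧ ¬ Go.Adj i j) → A i j = 0)}

/-- The nullity of a matrix: the dimension of its kernel. -/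
noncomputable def matNullity {V : Type*} [Fintype V] (A : Matrix V V ℝ) : ℕ :=
  Module.finrank ℝ (LinearMap.ker A.mulVecLin)

/-- The Strong Arnold Property for a matrix with respect to a signed graph `(Ge, Go)`. -/
def HasSAP {V : Type*} [Fintype V] (Ge Go : SimpleGraph V) (A : Matrix V V ℝ) : Prop :=
  ∀ X : Matrix V V ℝ, X.IsSymm →
    (∀ i j, (i = j ∨ (Ge ⊔ Go).Adj i j) → X i j = 0) →
    A * X = 0 → X = 0

/-- `ν(Ge, Go)`: the maximum nullity of a positive semidefinite matrix in `S(Ge, Go)`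
having the Strong Arnold Property. -/
noncomputable def nuSigned {V : Type*} [Fintype V] (Ge Go : SimpleGraph V) : ℕ :=
  sSup {n | ∃ A ∈ SignedSet Ge Go, A.PosSemidef ∧ HasSAP Ge Go A ∧ matNullity A = n}

/-- `M₊(Ge, Go)`: the maximum nullity of a positive semidefinite matrix in `S(Ge, Go)`. -/
noncomputable def MplusSigned {V : Type*} [Fintype V] (Ge Go : SimpleGraph V) : ℕ :=
  sSup {n | ∃ A ∈ SignedSet Ge Go, A.PosSemidef ∧ matNullity A = n}

/-- A signed graph `(Ge, Go)` is bipartite (balanced) if some set `U` of vertices meets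
every odd edge in exactly one end and every even edge in both ends or neither end. -/
def IsBalanced {V : Type*} (Ge Go : SimpleGraph V) : Prop :=
  ∃ U : Set V, (∀ i j, Go.Adj i j → ((i ∈ U) ↔ j ∉ U)) ∧
    (∀ i j, Ge.Adj i j → ((i ∈ U) ↔ j ∈ U))


/-- The Schur complement of `A` at `v`. -/
noncomputable def schurAt {V : Type*} (A : Matrix V V ℝ) (v : V) :
    Matrix {x : V // x ≠ v} {x : V // x ≠ v} ℝ :=
  fun x y => A x y - A x v * A v y / A v v

lemma mulVec_at {V : Type*} [Fintype V] [DecidableEq V] (A : Matrix V V ℝ) (v y : V) (x : V → ℝ) :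
    (A *ᵥ x) y = A y v * x v + ∑ z : {z : V // z ≠ v}, A y z * x z := by
  simp only [Matrix.mulVec, dotProduct]
  exact Fintype.sum_eq_add_sum_subtype_ne (fun z => A y z * x z) v

lemma schur_mulVec {V : Type*} [Fintype V] [DecidableEq V] (A : Matrix V V ℝ) (v : V)
    (ha : A v v ≠ 0) (x : V → ℝ) (y : {y : V // y ≠ v}) :
    (A *ᵥ x) y = (schurAt A v *ᵥ (fun z => x z)) y + A y v / A v v * (A *ᵥ x) v := by
  rw [mulVec_at A v y, mulVec_at A v v]
  simp only [Matrix.mulVec, dotProduct, schurAt]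
  have : ∑ z : {z : V // z ≠ v}, (A y z - A y v * A v z / A v v) * x z
      = ∑ z : {z : V // z ≠ v}, A y z * x z
        - A y v / A v v * ∑ z : {z : V // z ≠ v}, A v z * x z := by
    rw [Finset.mul_sum, ← Finset.sum_sub_distrib]
    refine Finset.sum_congr rfl fun z _ => ?_
    ring
  rw [this]
  field_simp
  ring

lemma ker_iff {V : Type*} [Fintype V] [DecidableEq V] (A : Matrix V V ℝ) (v : V)
    (ha : A v v ≠ 0) (x : V → ℝ) :
    A *ᵥ x = 0 ↔ (A *ᵥ x) v = 0 ∧ schurAt A v *ᵥ (fun z => x z) = 0 := by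
  constructor
  · intro h
    have hv : (A *ᵥ x) v = 0 := by rw [h]; rfl
    refine ⟨hv, ?_⟩
    funext y
    have := schur_mulVec A v ha x y
    rw [hv, h] at this
    simpa using this.symm
  · rintro ⟨hv, h⟩
    funext y
    by_cases hy : y = v
    · subst hy; exact hv
    · have := schur_mulVec A v ha x ⟨y, hy⟩
      rw [hv, h] at this
      simpa using this

lemma schur_quad {V : Type*} [Fintype V] [DecidableEq V] (A : Matrix V V ℝ) (v : V)
    (hA : A.IsSymm) (ha : A v v ≠ 0) (x : V → ℝ) :
    x ⬝ᵥ (A *ᵥ x) = ((A *ᵥ x) v) ^ 2 / A v v +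
      (fun z : {z : V // z ≠ v} => x z) ⬝ᵥ (schurAt A v *ᵥ (fun z => x z)) := by
  have h1 : x ⬝ᵥ (A *ᵥ x) = x v * (A *ᵥ x) v + ∑ z : {z : V // z ≠ v}, x z * (A *ᵥ x) z :=
    Fintype.sum_eq_add_sum_subtype_ne (fun z => x z * (A *ᵥ x) z) v
  rw [h1]
  simp_rw [schur_mulVec A v ha x]
  simp only [mul_add, Finset.sum_add_distrib]
  have h2 : ∑ z : {z : V // z ≠ v}, x z * (A z v / A v v * (A *ᵥ x) v)
      = (A *ᵥ x) v / A v v * ∑ z : {z : V // z ≠ v}, A v z * x z := by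
    rw [Finset.mul_sum]
    refine Finset.sum_congr rfl fun z _ => ?_
    rw [hA.apply]
    ring
  rw [h2]
  have h3 := mulVec_at A v v x
  have h4 : ∑ z : {z : V // z ≠ v}, A v z * x z = (A *ᵥ x) v - A v v * x v := by linarith
  rw [h4]
  simp only [dotProduct]
  field_simp
  ring

/-- The extension of a vector on `V - v` to `V` annihilating row `v` of `A`. -/
noncomputable def extV {V : Type*} [Fintype V] [DecidableEq V] (A : Matrix V V ℝ) (v : V) :
    ({x : V // x ≠ v} → ℝ) →ₗ[ℝ] (V → ℝ) where
  toFun y := fun x => if h : x ≠ v then y ⟨x, h⟩ else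
    -(∑ z : {z : V // z ≠ v}, A v z * y z) / A v v
  map_add' y z := by
    funext x
    by_cases h : x = v
    · simp [h, mul_add, Finset.sum_add_distrib]; ring
    · simp [h]
  map_smul' c z := by
    funext x
    by_cases h : x = v
    · simp only [h, ne_eq, not_true_eq_false, dite_false, Pi.smul_apply, smul_eq_mul,
        RingHom.id_apply]
      have : ∑ i : {z : V // z ≠ v}, A v i * (c * z i)
          = c * ∑ i : {z : V // z ≠ v}, A v i * z i := by
        rw [Finset.mul_sum]
        refine Finset.sum_congr rfl fun z _ => ?_
        ring
      rw [this]; ring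
    · simp [h]

lemma extV_ne {V : Type*} [Fintype V] [DecidableEq V] (A : Matrix V V ℝ) (v : V)
    (y : {x : V // x ≠ v} → ℝ) (z : {x : V // x ≠ v}) : extV A v y z = y z := by
  simp [extV, z.2]

lemma extV_v {V : Type*} [Fintype V] [DecidableEq V] (A : Matrix V V ℝ) (v : V)
    (y : {x : V // x ≠ v} → ℝ) :
    extV A v y v = -(∑ z : {z : V // z ≠ v}, A v z * y z) / A v v := by
  simp [extV]

lemma extV_row {V : Type*} [Fintype V] [DecidableEq V] (A : Matrix V V ℝ) (v : V)
    (ha : A v v ≠ 0) (y : {x : V // x ≠ v} → ℝ) : (A *ᵥ (extV A v y)) v = 0 := by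
  rw [mulVec_at A v, extV_v]
  simp_rw [extV_ne]
  field_simp
  ring

lemma extV_ker {V : Type*} [Fintype V] [DecidableEq V] (A : Matrix V V ℝ) (v : V)
    (ha : A v v ≠ 0) (y : {x : V // x ≠ v} → ℝ) (hy : schurAt A v *ᵥ y = 0) :
    A *ᵥ (extV A v y) = 0 := by
  rw [ker_iff A v ha]
  refine ⟨extV_row A v ha y, ?_⟩
  simp_rw [extV_ne]
  exact hy

lemma schur_symm {V : Type*} (A : Matrix V V ℝ) (v : V) (hA : A.IsSymm) :
    (schurAt A v).IsSymm := by
  ext x y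
  simp only [schurAt, transpose_apply]
  rw [hA.apply x y, hA.apply v y, hA.apply x v]
  ring

lemma psd_iff {V : Type*} [Fintype V] (A : Matrix V V ℝ) (hA : A.IsSymm) :
    A.PosSemidef ↔ ∀ x : V → ℝ, 0 ≤ x ⬝ᵥ (A *ᵥ x) := by
  rw [Matrix.posSemidef_iff_dotProduct_mulVec]
  constructor
  · intro h x
    simpa using h.2 x
  · intro h
    refine ⟨?_, fun x => by simpa using h x⟩
    rw [Matrix.IsHermitian, conjTranspose_eq_transpose_of_trivial]
    exact hA

lemma schur_psd {V : Type*} [Fintype V] [DecidableEq V] (A : Matrix V V ℝ) (v : V)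
    (hA : A.IsSymm) (ha : 0 < A v v) : A.PosSemidef ↔ (schurAt A v).PosSemidef := by
  rw [psd_iff A hA, psd_iff _ (schur_symm A v hA)]
  constructor
  · intro h y
    have h1 := h (extV A v y)
    rw [schur_quad A v hA ha.ne', extV_row A v ha.ne'] at h1
    simp_rw [extV_ne] at h1
    simpa using h1
  · intro h x
    rw [schur_quad A v hA ha.ne']
    have := h (fun z => x z)
    positivity

lemma schur_nullity {V : Type*} [Fintype V] [DecidableEq V] (A : Matrix V V ℝ) (v : V)
    (ha : A v v ≠ 0) : matNullity (schurAt A v) = matNullity A := by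
  have hinj : Function.Injective (extV A v) := by
    intro y z h
    funext t
    rw [← extV_ne A v y t, h, extV_ne]
  have : LinearMap.ker A.mulVecLin
      = (LinearMap.ker (schurAt A v).mulVecLin).map (extV A v) := by
    ext x
    simp only [LinearMap.mem_ker, Submodule.mem_map, Matrix.mulVecLin_apply]
    constructor
    · intro h
      have h' := (ker_iff A v ha x).1 h
      refine ⟨fun z => x z, h'.2, ?_⟩
      funext z
      by_cases hz : z = v
      · subst hz
        rw [extV_v]
        have h3 := mulVec_at A z z x
        rw [h'.1] at h3
        field_simp
        linarith
      · exact extV_ne A v _ ⟨z, hz⟩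
    · rintro ⟨y, hy, rfl⟩
      exact extV_ker A v ha y hy
  unfold matNullity
  rw [this]
  exact (LinearEquiv.finrank_eq (Submodule.equivMapOfInjective _ hinj _))

lemma mul_zero_iff_cols {V : Type*} [Fintype V] (A X : Matrix V V ℝ) :
    A * X = 0 ↔ ∀ j, A *ᵥ (fun i => X i j) = 0 := by
  constructor
  · intro h j
    funext i
    have := congrFun (congrFun h i) j
    simpa [Matrix.mul_apply, Matrix.mulVec, dotProduct] using this
  · intro h
    ext i j
    have := congrFun (h j) i
    simpa [Matrix.mul_apply, Matrix.mulVec, dotProduct] using this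

lemma sum_two {V : Type*} [Fintype V] [DecidableEq V] (A : Matrix V V ℝ) (v u w : V)
    (huw : u ≠ w) (huv : u ≠ v) (hwv : w ≠ v)
    (h0 : ∀ x, x ≠ v → x ≠ u → x ≠ w → A v x = 0) (y : {x : V // x ≠ v} → ℝ) :
    ∑ z : {z : V // z ≠ v}, A v z * y z = A v u * y ⟨u, huv⟩ + A v w * y ⟨w, hwv⟩ := by
  have hne : (⟨u, huv⟩ : {x : V // x ≠ v}) ≠ ⟨w, hwv⟩ := by
    intro h; exact huw (congrArg Subtype.val h)
  rw [← Finset.sum_pair (f := fun z : {z : V // z ≠ v} => A v z * y z) hne]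
  symm
  apply Finset.sum_subset (Finset.subset_univ _)
  intro z _ hz
  simp only [Finset.mem_insert, Finset.mem_singleton, not_or] at hz
  rw [h0 z z.2 (fun h => hz.1 (Subtype.ext h)) (fun h => hz.2 (Subtype.ext h)), zero_mul]

lemma schur_sap {V : Type*} [Fintype V] [DecidableEq V] (Ge Go : SimpleGraph V)
    (A : Matrix V V ℝ) (v u w : V)
    (huw : u ≠ w) (huv : u ≠ v) (hwv : w ≠ v)
    (hnbr : ∀ x, (Ge ⊔ Go).Adj v x ↔ (x = u ∨ x = w))
    (Ge₁ Go₁ : SimpleGraph {x : V // x ≠ v})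
    (hG : ∀ x y : {x : V // x ≠ v}, (Ge₁ ⊔ Go₁).Adj x y ↔
      ((Ge ⊔ Go).Adj x y ∨ (((x : V) = u ∧ (y : V) = w) ∨ ((x : V) = w ∧ (y : V) = u))))
    (ha : A v v ≠ 0)
    (h0 : ∀ x, x ≠ v → x ≠ u → x ≠ w → A v x = 0) (hw0 : A v w ≠ 0) :
    HasSAP Ge₁ Go₁ (schurAt A v) ↔ HasSAP Ge Go A := by
  constructor
  · intro h X hX hz hAX
    rw [mul_zero_iff_cols] at hAX
    have hrow : ∀ j, A v v * X v j + (A v u * X u j + A v w * X w j) = 0 := by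
      intro j
      have h1 := mulVec_at A v v (fun i => X i j)
      rw [hAX j, sum_two A v u w huw huv hwv h0 (fun z => X z j)] at h1
      simpa using h1.symm
    have hXvu : X v u = 0 := hz v u (Or.inr ((hnbr u).2 (Or.inl rfl)))
    have hXuu : X u u = 0 := hz u u (Or.inl rfl)
    have hXwu : X w u = 0 := by
      have := hrow u
      rw [hXvu, hXuu] at this
      simpa [hw0] using this
    have hXuw : X u w = 0 := by rw [← hXwu]; exact hX.apply w u
    have hX' : (fun x y : {x : V // x ≠ v} => X x y : Matrix _ _ ℝ) = 0 := by
      apply h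
      · ext x y
        exact hX.apply x y
      · intro i j hij
        rcases hij with hij | hij
        · exact hz i j (Or.inl (congrArg _ hij))
        · rcases (hG i j).1 hij with h1 | ⟨h1, h2⟩ | ⟨h1, h2⟩
          · exact hz i j (Or.inr h1)
          · simp only [h1, h2]; exact hXuw
          · simp only [h1, h2]; exact hXwu
      · refine (mul_zero_iff_cols _ _).2 ?_
        intro j
        exact ((ker_iff A v ha _).1 (hAX j)).2
    have hX2 : ∀ x y, x ≠ v → y ≠ v → X x y = 0 := fun x y hx hy =>
      congrFun (congrFun hX' ⟨x, hx⟩) ⟨y, hy⟩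
    have hXv : ∀ y, X v y = 0 := by
      intro y
      by_cases hy : y = v
      · exact hz v y (Or.inl hy.symm)
      · have := hrow y
        rw [hX2 u y huv hy, hX2 w y hwv hy] at this
        simpa [ha] using this
    ext x y
    by_cases hx : x = v
    · rw [hx]; exact hXv y
    · by_cases hy : y = v
      · rw [hy, ← hX.apply x v]; exact hXv x
      · exact hX2 x y hx hy
  · intro h X hX hz hBX
    rw [mul_zero_iff_cols] at hBX
    -- R extends every column
    let u' : {x : V // x ≠ v} := ⟨u, huv⟩
    let w' : {x : V // x ≠ v} := ⟨w, hwv⟩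
    let r : {x : V // x ≠ v} → ℝ := fun j => extV A v (fun i => X i j) v
    have hr : ∀ j, r j = -(A v u * X u' j + A v w * X w' j) / A v v := by
      intro j
      simp only [r]
      rw [extV_v, sum_two A v u w huw huv hwv h0]
    have hXuw : X u' w' = 0 := hz _ _ (Or.inr ((hG _ _).2 (Or.inr (Or.inl ⟨rfl, rfl⟩))))
    have hXwu : X w' u' = 0 := hz _ _ (Or.inr ((hG _ _).2 (Or.inr (Or.inr ⟨rfl, rfl⟩))))
    have hru : r u' = 0 := by rw [hr, hz u' u' (Or.inl rfl), hXwu]; simp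
    have hrw : r w' = 0 := by rw [hr, hz w' w' (Or.inl rfl), hXuw]; simp
    let Y : Matrix V V ℝ := fun x y =>
      if hx : x = v then (if hy : y = v then 0 else r ⟨y, hy⟩)
      else (if hy : y = v then r ⟨x, hx⟩ else X ⟨x, hx⟩ ⟨y, hy⟩)
    have hYvv : Y v v = 0 := by simp [Y]
    have hYv : ∀ y : {x : V // x ≠ v}, Y v y = r y := fun y => by simp [Y, y.2]
    have hYv' : ∀ y : {x : V // x ≠ v}, Y y v = r y := fun y => by simp [Y, y.2]
    have hYX : ∀ x y : {x : V // x ≠ v}, Y x y = X x y := fun x y => by simp [Y, x.2, y.2]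
    have hcol : ∀ y : {x : V // x ≠ v}, (fun i => Y i y) = extV A v (fun i => X i y) := by
      intro y
      funext i
      by_cases hi : i = v
      · rw [hi, hYv]
      · exact (hYX ⟨i, hi⟩ y).trans (extV_ne A v (fun i => X i y) ⟨i, hi⟩).symm
    have hYker : ∀ y : {x : V // x ≠ v}, A *ᵥ (fun i => Y i y) = 0 := by
      intro y
      rw [hcol]
      exact extV_ker A v ha _ (hBX y)
    have hcolv : (fun i => Y i v) = (fun i => -(A v u * Y i u + A v w * Y i w) / A v v) := by
      funext i
      by_cases hi : i = v
      · rw [hi, hYvv, hYv u', hYv w', hru, hrw]; simp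
      · have e1 := hYv' ⟨i, hi⟩
        have e2 := hYX ⟨i, hi⟩ u'
        have e3 := hYX ⟨i, hi⟩ w'
        have e4 := hX.apply ⟨i, hi⟩ u'
        have e5 := hX.apply ⟨i, hi⟩ w'
        have e6 := hr ⟨i, hi⟩
        simp only [u', w'] at e1 e2 e3 e4 e5 e6
        rw [e1, e2, e3, e6, e4, e5]
    have hY : Y = 0 := by
      apply h
      · ext x y
        rw [transpose_apply]
        by_cases hx : x = v
        · by_cases hy : y = v
          · rw [hx, hy]
          · rw [hx, hYv' ⟨y, hy⟩, hYv ⟨y, hy⟩]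
        · by_cases hy : y = v
          · rw [hy, hYv' ⟨x, hx⟩, hYv ⟨x, hx⟩]
          · rw [hYX ⟨x, hx⟩ ⟨y, hy⟩, hYX ⟨y, hy⟩ ⟨x, hx⟩, hX.apply]
      · have key : ∀ j, (v = j ∨ (Ge ⊔ Go).Adj v j) → Y v j = 0 ∧ Y j v = 0 := by
          intro j hj
          rcases hj with hj | hj
          · rw [← hj]; exact ⟨hYvv, hYvv⟩
          · rcases (hnbr j).1 hj with hj | hj
            · rw [hj, hYv u', hYv' u']; exact ⟨hru, hru⟩
            · rw [hj, hYv w', hYv' w']; exact ⟨hrw, hrw⟩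
        intro i j hij
        by_cases hi : i = v
        · subst hi; exact (key j hij).1
        · by_cases hj : j = v
          · subst hj
            exact (key i (hij.imp Eq.symm (fun h => h.symm))).2
          · rw [hYX ⟨i, hi⟩ ⟨j, hj⟩]
            apply hz
            rcases hij with hij | hij
            · exact Or.inl (Subtype.ext hij)
            · exact Or.inr ((hG _ _).2 (Or.inl hij))
      · rw [mul_zero_iff_cols]
        intro j
        by_cases hj : j = v
        · rw [hj, hcolv]
          have : (fun i => -(A v u * Y i u + A v w * Y i w) / A v v)
            = (-(A v u) / A v v) • (fun i => Y i u) + (-(A v w) / A v v) • (fun i => Y i w) := by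
            funext i
            simp only [Pi.add_apply, Pi.smul_apply, smul_eq_mul]
            ring
          rw [this, mulVec_add, mulVec_smul, mulVec_smul, hYker u', hYker w']
          simp
        · exact hYker ⟨j, hj⟩
    ext x y
    rw [← hYX, hY]; rfl

set_option maxHeartbeats 2000000 in
lemma choose_entries (eu ou ew ow e o : Prop) (b : ℝ) (hu : eu ∨ ou) (hw : ew ∨ ow)
    (honeu : ¬ (eu ∧ ou)) (honew : ¬ (ew ∧ ow))
    (hb1 : (e ∨ (ou ↔ ow)) ∧ ¬ (o ∨ ¬ (ou ↔ ow)) → b < 0)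
    (hb2 : (o ∨ ¬ (ou ↔ ow)) ∧ ¬ (e ∨ (ou ↔ ow)) → 0 < b) :
    ∃ p q : ℝ, p ≠ 0 ∧ q ≠ 0 ∧
        (eu → p < 0) ∧ (ou → 0 < p) ∧ (ew → q < 0) ∧ (ow → 0 < q) ∧
        ((e ∧ ¬ o) → b + p * q < 0) ∧
        ((o ∧ ¬ e) → 0 < b + p * q) ∧
        ((¬ e ∧ ¬ o) → b + p * q = 0) := by
  -- magnitude choices
  have hplus : ((ou ↔ ow)) → ∃ t : ℝ, 0 < t ∧
      ((e ∧ ¬ o) → b + t < 0) ∧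
      ((o ∧ ¬ e) → 0 < b + t) ∧
      ((¬ e ∧ ¬ o) → b + t = 0) := by
    intro hs
    by_cases hgo : o
    · refine ⟨|b| + 1, by positivity, by grind, fun _ => ?_, by grind⟩
      linarith [neg_abs_le b]
    · have hb : b < 0 := hb1 (by grind)
      by_cases hge : e
      · exact ⟨-b / 2, by linarith, fun _ => by linarith, by grind, by grind⟩
      · exact ⟨-b, by linarith, by grind, by grind, fun _ => by linarith⟩
  have hminus : (¬ (ou ↔ ow)) → ∃ t : ℝ, 0 < t ∧
      ((e ∧ ¬ o) → b - t < 0) ∧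
      ((o ∧ ¬ e) → 0 < b - t) ∧
      ((¬ e ∧ ¬ o) → b - t = 0) := by
    intro hs
    by_cases hge : e
    · refine ⟨|b| + 1, by positivity, fun _ => ?_, by grind, by grind⟩
      linarith [le_abs_self b]
    · have hb : 0 < b := hb2 (by grind)
      by_cases hgo : o
      · exact ⟨b / 2, by linarith, by grind, fun _ => by linarith, by grind⟩
      · exact ⟨b, by linarith, by grind, by grind, fun _ => by linarith⟩
  by_cases hou : ou <;> by_cases how : ow
  · obtain ⟨t, ht, k1, k2, k3⟩ := hplus (by grind)
    refine ⟨t, 1, ht.ne', by norm_num, by grind, by grind, by grind, fun _ => by norm_num, ?_⟩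
    simpa using ⟨fun a b => k1 ⟨a, b⟩, fun a b => k2 ⟨a, b⟩, fun a b => k3 ⟨a, b⟩⟩
  · obtain ⟨t, ht, k1, k2, k3⟩ := hminus (by grind)
    refine ⟨t, -1, ht.ne', by norm_num, by grind, by grind, fun _ => by norm_num, by grind, ?_⟩
    rw [show b + t * (-1) = b - t by ring]
    exact ⟨k1, k2, k3⟩
  · obtain ⟨t, ht, k1, k2, k3⟩ := hminus (by grind)
    refine ⟨-t, 1, neg_ne_zero.2 ht.ne',
      by norm_num, fun _ => by linarith, by grind, by grind, fun _ => by norm_num, ?_⟩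
    rw [show b + (-t) * 1 = b - t by ring]
    exact ⟨k1, k2, k3⟩
  · obtain ⟨t, ht, k1, k2, k3⟩ := hplus (by grind)
    refine ⟨-t, -1, neg_ne_zero.2 ht.ne',
      by norm_num, fun _ => by linarith, by grind, fun _ => by norm_num, by grind, ?_⟩
    rw [show b + (-t) * (-1) = b + t by ring]
    exact ⟨k1, k2, k3⟩

set_option maxHeartbeats 2000000 in
/-- a series reduction at a degree-two vertex `v` preserves `ν`. -/
theorem stmt7 {V : Type*} [Fintype V] [DecidableEq V]
    (Ge Go : SimpleGraph V) (v u w : V) (huw : u ≠ w)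
    (hnbr : ∀ x, (Ge ⊔ Go).Adj v x ↔ (x = u ∨ x = w))
    (honeu : ¬(Ge.Adj v u ∧ Go.Adj v u)) (honew : ¬(Ge.Adj v w ∧ Go.Adj v w))
    (Ge₁ Go₁ : SimpleGraph {x : V // x ≠ v})
    (hGe₁ : ∀ x y : {x : V // x ≠ v}, Ge₁.Adj x y ↔
      (Ge.Adj (x : V) (y : V) ∨
        ((((x : V) = u ∧ (y : V) = w) ∨ ((x : V) = w ∧ (y : V) = u)) ∧
          (Go.Adj v u ↔ Go.Adj v w))))
    (hGo₁ : ∀ x y : {x : V // x ≠ v}, Go₁.Adj x y ↔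
      (Go.Adj (x : V) (y : V) ∨
        ((((x : V) = u ∧ (y : V) = w) ∨ ((x : V) = w ∧ (y : V) = u)) ∧
          ¬(Go.Adj v u ↔ Go.Adj v w)))) :
    nuSigned Ge₁ Go₁ = nuSigned Ge Go := by
  have hadj : ∀ x, (Ge.Adj v x ∨ Go.Adj v x) ↔ (x = u ∨ x = w) := fun x => by
    rw [← hnbr x, SimpleGraph.sup_adj]
  have huv : u ≠ v := by
    rintro rfl
    exact ((Ge ⊔ Go).loopless.irrefl u) ((hnbr u).2 (Or.inl rfl))
  have hwv : w ≠ v := by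
    rintro rfl
    exact ((Ge ⊔ Go).loopless.irrefl w) ((hnbr w).2 (Or.inr rfl))
  have hu := (hadj u).2 (Or.inl rfl)
  have hw := (hadj w).2 (Or.inr rfl)
  have hG : ∀ x y : {x : V // x ≠ v}, (Ge₁ ⊔ Go₁).Adj x y ↔
      ((Ge ⊔ Go).Adj x y ∨ (((x : V) = u ∧ (y : V) = w) ∨ ((x : V) = w ∧ (y : V) = u))) := by
    intro x y
    rw [SimpleGraph.sup_adj, SimpleGraph.sup_adj, hGe₁, hGo₁]
    tauto
  unfold nuSigned
  congr 1
  ext n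
  simp only [Set.mem_ofPred_eq]
  constructor
  · rintro ⟨B, ⟨hBs, hB⟩, hpsd, hsap, hn⟩
    let u' : {x : V // x ≠ v} := ⟨u, huv⟩
    let w' : {x : V // x ≠ v} := ⟨w, hwv⟩
    -- choose the two new entries
    obtain ⟨p, q, hp, hq, hpe, hpo, hqe, hqo, h1, h2, h3⟩ : ∃ p q : ℝ, p ≠ 0 ∧ q ≠ 0 ∧
        (Ge.Adj v u → p < 0) ∧ (Go.Adj v u → 0 < p) ∧
        (Ge.Adj v w → q < 0) ∧ (Go.Adj v w → 0 < q) ∧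
        ((Ge.Adj u w ∧ ¬ Go.Adj u w) → B u' w' + p * q < 0) ∧
        ((Go.Adj u w ∧ ¬ Ge.Adj u w) → 0 < B u' w' + p * q) ∧
        ((¬ Ge.Adj u w ∧ ¬ Go.Adj u w) → B u' w' + p * q = 0) := by
      obtain ⟨hb1, hb2, hb3⟩ := hB u' w'
      rw [hGe₁, hGo₁] at hb1 hb2 hb3
      simp only [u', w', true_and, true_or] at hb1 hb2 hb3
      generalize B ⟨u, huv⟩ ⟨w, hwv⟩ = b at hb1 hb2 hb3
      exact choose_entries _ _ _ _ _ _ b hu hw honeu honew hb1 (fun h => hb2 h)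
    let c : V → ℝ := fun x => if x = v then 1 else if x = u then p else if x = w then q else 0
    have hcv : c v = 1 := by simp [c]
    have hcu : c u = p := by simp [c, huv]
    have hcw : c w = q := by simp [c, hwv, huw.symm]
    have hc0 : ∀ x, x ≠ v → x ≠ u → x ≠ w → c x = 0 := fun x a b d => by simp [c, a, b, d]
    let A : Matrix V V ℝ := fun x y =>
      (if h : x ≠ v ∧ y ≠ v then B ⟨x, h.1⟩ ⟨y, h.2⟩ else 0) + c x * c y
    have hAv : ∀ y, A v y = c y := fun y => by simp [A, hcv]
    have hAv' : ∀ y, A y v = c y := fun y => by simp [A, hcv]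
    have hAB : ∀ x y : {x : V // x ≠ v}, A x y = B x y + c x * c y := fun x y => by
      simp [A, x.2, y.2]
    have hAvv : A v v = 1 := by rw [hAv, hcv]
    have hAs : A.IsSymm := by
      ext x y
      rw [transpose_apply]
      by_cases hx : x = v
      · rw [hx, hAv, hAv']
      · by_cases hy : y = v
        · rw [hy, hAv, hAv']
        · rw [hAB ⟨x, hx⟩ ⟨y, hy⟩, hAB ⟨y, hy⟩ ⟨x, hx⟩, hBs.apply, mul_comm]
    have hS : schurAt A v = B := by
      ext x y
      simp only [schurAt]
      rw [hAB, hAv, hAv', hAvv]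
      ring
    have hApos : 0 < A v v := by rw [hAvv]; norm_num
    refine ⟨A, ⟨hAs, ?_⟩, ?_, ?_, ?_⟩
    · have hAvx : ∀ x, ((Ge.Adj v x ∧ ¬ Go.Adj v x) → A v x < 0) ∧
          ((Go.Adj v x ∧ ¬ Ge.Adj v x) → 0 < A v x) ∧
          ((v ≠ x ∧ ¬ Ge.Adj v x ∧ ¬ Go.Adj v x) → A v x = 0) := by
        intro x
        rw [hAv]
        by_cases hxu : x = u
        · subst hxu; rw [hcu]; exact ⟨fun h => hpe h.1, fun h => hpo h.1, fun h => by grind⟩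
        · by_cases hxw : x = w
          · subst hxw; rw [hcw]; exact ⟨fun h => hqe h.1, fun h => hqo h.1, fun h => by grind⟩
          · have := hadj x
            refine ⟨by grind, by grind, fun h => hc0 x h.1.symm hxu hxw⟩
      intro i j
      by_cases hi : i = v
      · subst hi; exact hAvx j
      by_cases hj : j = v
      · subst hj
        have := hAvx i
        rw [hAs.apply i j] at this
        rw [Ge.adj_comm i j, Go.adj_comm i j, ne_comm]
        exact this
      have hBij := hB ⟨i, hi⟩ ⟨j, hj⟩
      rw [hGe₁, hGo₁] at hBij
      have hABij := hAB ⟨i, hi⟩ ⟨j, hj⟩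
      simp only at hBij hABij
      by_cases hc : (i = u ∧ j = w)
      · obtain ⟨rfl, rfl⟩ := hc
        rw [hABij, hcu, hcw]
        exact ⟨h1, h2, fun h => h3 h.2⟩
      by_cases hc' : (i = w ∧ j = u)
      · obtain ⟨rfl, rfl⟩ := hc'
        rw [hABij, hcu, hcw, Ge.adj_comm, Go.adj_comm, mul_comm q p, hBs.apply]
        exact ⟨h1, h2, fun h => h3 h.2⟩
      by_cases hij : i = j
      · subst hij
        exact ⟨fun h => absurd h.1 (Ge.loopless.irrefl i), fun h => absurd h.1 (Go.loopless.irrefl i),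
          fun h => absurd rfl h.1⟩
      have hcc : c i * c j = 0 := by
        by_cases k1 : i = u
        · have : c j = 0 := hc0 j hj (fun h => hij (k1.trans h.symm)) (fun h => hc ⟨k1, h⟩)
          rw [this, mul_zero]
        · by_cases k2 : i = w
          · have : c j = 0 := hc0 j hj (fun h => hc' ⟨k2, h⟩) (fun h => hij (k2.trans h.symm))
            rw [this, mul_zero]
          · rw [hc0 i hi k1 k2, zero_mul]
      rw [hABij, hcc, add_zero]
      simp only [hc, hc', or_self, false_and, or_false, ne_eq, Subtype.mk.injEq] at hBij
      exact hBij
    · rw [schur_psd A v hAs hApos, hS]; exact hpsd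
    · rw [← schur_sap Ge Go A v u w huw huv hwv hnbr Ge₁ Go₁ hG hApos.ne', hS]
      · exact hsap
      · intro x a b d; rw [hAv, hc0 x a b d]
      · rw [hAv, hcw]; exact hq
    · rw [← schur_nullity A v hApos.ne', hS]; exact hn
  · rintro ⟨A, ⟨hAs, hA⟩, hpsd, hsap, hn⟩
    have h0 : ∀ x, x ≠ v → x ≠ u → x ≠ w → A v x = 0 := by
      intro x a b d
      have := hadj x
      exact (hA v x).2.2 ⟨a.symm, by grind⟩
    have hwne : A v w ≠ 0 := by
      rcases hw with h | h
      · exact ((hA v w).1 ⟨h, by grind⟩).ne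
      · exact ((hA v w).2.1 ⟨h, by grind⟩).ne'
    have hApos : 0 < A v v := by
      have hq := (psd_iff A hAs).1 hpsd
      have hquad : ∀ s : ℝ, 0 ≤ A v v * s ^ 2 + 2 * A v w * s + A w w := by
        intro s
        have := hq (s • Pi.single v 1 + Pi.single w 1)
        simp only [mulVec_add, mulVec_smul, dotProduct_add, add_dotProduct, smul_dotProduct,
          dotProduct_smul, Matrix.mulVec_single_one, single_one_dotProduct, Matrix.col_apply,
          smul_eq_mul] at this
        have e := hAs.apply v w
        rw [e] at this
        linarith
      by_contra hle
      have hsq : 0 < (A v w) ^ 2 := by positivity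
      have := hquad (-(|A w w| + 1) / (A v w))
      have e1 : 2 * A v w * (-(|A w w| + 1) / (A v w)) = -2 * (|A w w| + 1) := by
        field_simp
      rw [e1] at this
      have e2 : A v v * (-(|A w w| + 1) / (A v w)) ^ 2 ≤ 0 :=
        mul_nonpos_of_nonpos_of_nonneg (not_lt.1 hle) (sq_nonneg _)
      linarith [le_abs_self (A w w), abs_nonneg (A w w)]
    refine ⟨schurAt A v, ⟨schur_symm A v hAs, ?_⟩, ?_, ?_, ?_⟩
    · have hAu := hA v u
      have hAw := hA v w
      have hAuw := hA u w
      have hmain : ((Ge₁.Adj ⟨u, huv⟩ ⟨w, hwv⟩ ∧ ¬ Go₁.Adj ⟨u, huv⟩ ⟨w, hwv⟩) →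
            A u w - A v u * A v w / A v v < 0) ∧
          ((Go₁.Adj ⟨u, huv⟩ ⟨w, hwv⟩ ∧ ¬ Ge₁.Adj ⟨u, huv⟩ ⟨w, hwv⟩) →
            0 < A u w - A v u * A v w / A v v) ∧
          ((u ≠ w ∧ ¬ Ge₁.Adj ⟨u, huv⟩ ⟨w, hwv⟩ ∧ ¬ Go₁.Adj ⟨u, huv⟩ ⟨w, hwv⟩) →
            A u w - A v u * A v w / A v v = 0) := by
        rw [hGe₁, hGo₁]
        simp only [true_and, true_or]
        refine ⟨?_, ?_, fun h => by grind⟩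
        · rintro ⟨-, h⟩
          have hs : Go.Adj v u ↔ Go.Adj v w := by grind
          have hng : ¬ Go.Adj u w := by grind
          have hle : A u w ≤ 0 := by
            by_cases hge : Ge.Adj u w
            · exact (hAuw.1 ⟨hge, hng⟩).le
            · exact (hAuw.2.2 ⟨huw, hge, hng⟩).le
          have hprod : 0 < A v u * A v w := by
            by_cases hou : Go.Adj v u
            · exact mul_pos (hAu.2.1 (by grind)) (hAw.2.1 (by grind))
            · exact mul_pos_of_neg_of_neg (hAu.1 (by grind)) (hAw.1 (by grind))
          have := div_pos hprod hApos
          linarith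
        · rintro ⟨-, h⟩
          have hs : ¬ (Go.Adj v u ↔ Go.Adj v w) := by grind
          have hng : ¬ Ge.Adj u w := by grind
          have hle : 0 ≤ A u w := by
            by_cases hge : Go.Adj u w
            · exact (hAuw.2.1 ⟨hge, hng⟩).le
            · exact (hAuw.2.2 ⟨huw, hng, hge⟩).ge
          have hprod : A v u * A v w < 0 := by
            by_cases hou : Go.Adj v u
            · exact mul_neg_of_pos_of_neg (hAu.2.1 (by grind)) (hAw.1 (by grind))
            · exact mul_neg_of_neg_of_pos (hAu.1 (by grind)) (hAw.2.1 (by grind))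
          have := div_neg_of_neg_of_pos hprod hApos
          linarith
      rintro ⟨i, hi⟩ ⟨j, hj⟩
      simp only [schurAt]
      rw [hAs.apply v i]
      by_cases hc : (i = u ∧ j = w)
      · obtain ⟨rfl, rfl⟩ := hc
        simpa only [ne_eq, Subtype.mk.injEq] using hmain
      by_cases hc' : (i = w ∧ j = u)
      · obtain ⟨rfl, rfl⟩ := hc'
        rw [Ge₁.adj_comm, Go₁.adj_comm, mul_comm (A v i), ← hAs.apply i j, ne_comm]
        simpa only [ne_eq, Subtype.mk.injEq] using hmain
      by_cases hij : i = j
      · subst hij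
        exact ⟨fun h => absurd h.1 (Ge₁.loopless.irrefl _),
          fun h => absurd h.1 (Go₁.loopless.irrefl _), fun h => absurd rfl h.1⟩
      have hcc : A v i * A v j = 0 := by
        by_cases k1 : i = u
        · have : A v j = 0 := h0 j hj (fun h => hij (k1.trans h.symm)) (fun h => hc ⟨k1, h⟩)
          rw [this, mul_zero]
        · by_cases k2 : i = w
          · have : A v j = 0 := h0 j hj (fun h => hc' ⟨k2, h⟩) (fun h => hij (k2.trans h.symm))
            rw [this, mul_zero]
          · rw [h0 i hi k1 k2, zero_mul]
      rw [hcc, zero_div, sub_zero, hGe₁, hGo₁]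
      simp only [hc, hc', or_self, false_and, or_false, ne_eq, Subtype.mk.injEq]
      exact hA i j
    · rw [← schur_psd A v hAs hApos]; exact hpsd
    · rw [schur_sap Ge Go A v u w huw huv hwv hnbr Ge₁ Go₁ hG hApos.ne' h0 hwne]
      exact hsap
    · rw [schur_nullity A v hApos.ne']; exact hn
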